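/- For all τ in the complex upper half-plane and all z ∈ ℂ: ch[1,0](τ,z)² = −(1/2)·[η(τ)³/(η(τ/2)η(2τ)) + η(τ/2)η(2τ)/η(τ)²]·ch[2,0](τ,z) + (1/2)·[η(τ)³/(η(τ/2)η(2τ)) − η(τ/2)η(2τ)/η(τ)²]·ch[2,2](τ,z). -/

import Mathlib

open Complex

/-- Jacobi theta function `θ_{j,m}(τ,z) = Σ_{n ∈ j/(2m)+ℤ} q^{m n²} e^{2πi m n z}`. -/
noncomputable def jTheta (j m : ℝ) (τ z : ℂ) : ℂ :=
  ∑' n : ℤ, Complex.exp (2 * (Real.pi : ℂ) * Complex.I * (m : ℂ) *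
    (((j / (2 * m) + (n : ℝ) : ℝ) : ℂ) ^ 2 * τ + ((j / (2 * m) + (n : ℝ) : ℝ) : ℂ) * z))

/-- `q^a := e^{2πiaτ}`. -/
noncomputable def qpow (τ : ℂ) (a : ℝ) : ℂ :=
  Complex.exp (2 * (Real.pi : ℂ) * Complex.I * (a : ℂ) * τ)

/-- Dedekind eta function. -/
noncomputable def dedekindEta (τ : ℂ) : ℂ :=
  Complex.exp ((Real.pi : ℂ) * Complex.I * τ / 12) *
    ∏' n : ℕ, (1 - Complex.exp (2 * (Real.pi : ℂ) * Complex.I * ((n : ℂ) + 1) * τ))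

/-- Mumford theta `ϑ00`. -/
noncomputable def v00 (τ z : ℂ) : ℂ := jTheta 0 2 τ z + jTheta 2 2 τ z
/-- Mumford theta `ϑ01`. -/
noncomputable def v01 (τ z : ℂ) : ℂ := jTheta 0 2 τ z - jTheta 2 2 τ z
/-- Mumford theta `ϑ10`. -/
noncomputable def v10 (τ z : ℂ) : ℂ := jTheta 1 2 τ z + jTheta (-1) 2 τ z
/-- N=3 character `ch^{(+)}_{H(Λ^{[K(1),0]})}`. -/
noncomputable def ch10 (τ z : ℂ) : ℂ := -(jTheta 0 1 τ z) / dedekindEta τ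
/-- N=3 character `ch^{(+)}_{H(Λ^{[K(1),1]})}`. -/
noncomputable def ch11 (τ z : ℂ) : ℂ := -Complex.I * (jTheta 1 1 τ z / dedekindEta τ)
/-- N=3 character `ch^{(+)}_{H(Λ^{[K(2),0]})}`. -/
noncomputable def ch20 (τ z : ℂ) : ℂ :=
  -(1 / 2) * ((dedekindEta (τ / 2) / (dedekindEta τ * dedekindEta (2 * τ))) * v01 τ z
    + (1 / (dedekindEta (τ / 2) * dedekindEta (2 * τ))) * v00 τ z)
/-- N=3 character `ch^{(+)}_{H(Λ^{[K(2),2]})}`. -/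
noncomputable def ch22 (τ z : ℂ) : ℂ :=
  -(1 / 2) * ((dedekindEta (τ / 2) / (dedekindEta τ * dedekindEta (2 * τ))) * v01 τ z
    - (1 / (dedekindEta (τ / 2) * dedekindEta (2 * τ))) * v00 τ z)
/-- N=3 character `ch^{(+)}_{H(Λ^{[K(2),1]})}`. -/
noncomputable def ch21 (τ z : ℂ) : ℂ :=
  Complex.I * (dedekindEta (2 * τ) / (dedekindEta (τ / 2) * dedekindEta τ)) * v10 τ z
/-- N=3 character `ch^{(+)}_{H(Λ^{[K(4),1]})}`. -/
noncomputable def ch41 (τ z : ℂ) : ℂ :=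
  (Complex.I / 2) * (1 / (dedekindEta (τ / 2) * dedekindEta (2 * τ))) *
    (v01 τ z * v10 τ z + (dedekindEta (2 * τ) / (dedekindEta τ) ^ 2) * v00 τ z * v10 τ z)
/-- N=3 character `ch^{(+)}_{H(Λ^{[K(4),3]})}`. -/
noncomputable def ch43 (τ z : ℂ) : ℂ :=
  (Complex.I / 2) * (1 / (dedekindEta (τ / 2) * dedekindEta (2 * τ))) *
    (v01 τ z * v10 τ z - (dedekindEta (2 * τ) / (dedekindEta τ) ^ 2) * v00 τ z * v10 τ z)

open Filter Topology

/-- The finite `q`-Pochhammer product `(q; q)_n`. -/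
noncomputable def qPoch (q : ℂ) (n : ℕ) : ℂ := ∏ i ∈ Finset.range n, (1 - q ^ (i + 1))

/-- The reciprocal of `(q; q)_m`, extended by zero to negative integers `m`. -/
noncomputable def invQPoch (q : ℂ) : ℤ → ℂ
  | Int.ofNat n => (qPoch q n)⁻¹
  | Int.negSucc _ => 0

/-- The infinite product `(q; q)_∞`. -/
noncomputable def eulerProd (q : ℂ) : ℂ := ∏' n : ℕ, (1 - q ^ (n + 1))

/-- The infinite product `∏ (1 + s x^(2n+1))`. -/
noncomputable def oddProd (s x : ℂ) : ℂ := ∏' n : ℕ, (1 + s * x ^ (2 * n + 1))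

lemma one_sub_pow_succ_ne_zero {q : ℂ} (hq : ‖q‖ < 1) (n : ℕ) : 1 - q ^ (n + 1) ≠ 0 := by
  intro h
  have h1 : ‖q ^ (n + 1)‖ = 1 := by rw [← sub_eq_zero.mp h, norm_one]
  rw [norm_pow] at h1
  exact (pow_lt_one₀ (norm_nonneg q) hq n.succ_ne_zero).ne h1

lemma qPoch_ne_zero {q : ℂ} (hq : ‖q‖ < 1) (n : ℕ) : qPoch q n ≠ 0 :=
  Finset.prod_ne_zero_iff.mpr fun i _ ↦ one_sub_pow_succ_ne_zero hq i

lemma eulerProd_ne_zero {q : ℂ} (hq : ‖q‖ < 1) : eulerProd q ≠ 0 := by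
  simp only [eulerProd, sub_eq_add_neg]
  refine tprod_one_add_ne_zero_of_summable (f := fun n ↦ -q ^ (n + 1)) (fun n ↦ ?_) ?_
  · simpa [sub_eq_add_neg] using one_sub_pow_succ_ne_zero hq n
  · simpa using (summable_nat_add_iff 1).mpr (summable_geometric_of_lt_one (norm_nonneg _) hq)

lemma tendsto_qPoch {q : ℂ} (hq : ‖q‖ < 1) : Tendsto (qPoch q) atTop (𝓝 (eulerProd q)) :=
  (ModularForm.multipliable_one_sub_pow hq).hasProd.tendsto_prod_nat

lemma multipliable_oddProd (s : ℂ) {x : ℂ} (hx : ‖x‖ < 1) :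
    Multipliable fun n : ℕ ↦ 1 + s * x ^ (2 * n + 1) := by
  apply multipliable_one_add_of_summable
  have hinj : Function.Injective fun n : ℕ ↦ 2 * n + 1 := fun a b h ↦ by simpa using h
  simpa [Function.comp_def] using
    ((summable_geometric_of_lt_one (norm_nonneg _) hx).comp_injective hinj).mul_left ‖s‖

lemma invQPoch_succ {q : ℂ} (hq : ‖q‖ < 1) (m : ℤ) :
    (1 - q ^ (m + 1)) * invQPoch q (m + 1) = invQPoch q m := by
  rcases m with n | n | n
  · change (1 - q ^ ((n : ℤ) + 1)) * (qPoch q (n + 1))⁻¹ = (qPoch q n)⁻¹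
    have h1 := one_sub_pow_succ_ne_zero hq n
    have h2 := qPoch_ne_zero hq n
    rw [show q ^ ((n : ℤ) + 1) = q ^ (n + 1) by exact_mod_cast zpow_natCast q (n + 1),
      qPoch, Finset.prod_range_succ, ← qPoch]
    field_simp
  · simp [invQPoch]
  · rw [show Int.negSucc (n + 1) + 1 = Int.negSucc n by lia]
    simp [invQPoch]

lemma tendsto_invQPoch {q : ℂ} (hq : ‖q‖ < 1) :
    Tendsto (invQPoch q) atTop (𝓝 (eulerProd q)⁻¹) := by
  have h : Tendsto (fun m : ℤ ↦ (qPoch q m.toNat)⁻¹) atTop (𝓝 (eulerProd q)⁻¹) :=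
    ((tendsto_qPoch hq).inv₀ (eulerProd_ne_zero hq)).comp
      (tendsto_atTop_atTop.mpr fun b ↦ ⟨b, fun a ha ↦ by lia⟩)
  refine h.congr' ?_
  filter_upwards [eventually_ge_atTop 0] with m hm
  lift m to ℕ using hm
  rfl

lemma exists_norm_invQPoch_le {q : ℂ} (hq : ‖q‖ < 1) : ∃ C, ∀ m, ‖invQPoch q m‖ ≤ C := by
  obtain ⟨C, hC⟩ := (Metric.isBounded_range_of_tendsto _
    ((tendsto_qPoch hq).inv₀ (eulerProd_ne_zero hq))).exists_norm_le
  refine ⟨C, fun m ↦ ?_⟩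
  have h (n : ℕ) : ‖(qPoch q n)⁻¹‖ ≤ C := hC _ ⟨n, rfl⟩
  rcases m with n | n
  · exact h n
  · simpa [invQPoch] using (norm_nonneg _).trans (h 0)

/-- The finite form of the Jacobi triple product identity. -/
lemma hasSum_finite_tripleProduct {x ζ : ℂ} (hx : ‖x‖ < 1) (hx0 : x ≠ 0) (hζ : ζ ≠ 0) (N : ℕ) :
    HasSum (fun k : ℤ ↦ qPoch (x ^ 2) (2 * N) * invQPoch (x ^ 2) (N + k) *
        invQPoch (x ^ 2) (N - k) * (x ^ (k ^ 2) * ζ ^ k))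
      (∏ i ∈ Finset.range N, (1 + ζ * x ^ (2 * i + 1)) * (1 + ζ⁻¹ * x ^ (2 * i + 1))) := by
  have hq : ‖x ^ 2‖ < 1 := by
    rw [norm_pow]; exact pow_lt_one₀ (norm_nonneg x) hx two_ne_zero
  induction N with
  | zero =>
    convert hasSum_single (0 : ℤ) ?_ using 1
    · simp [qPoch, show invQPoch (x ^ 2) 0 = 1 by simp [invQPoch, qPoch]]
    · rintro (n | n) hn
      · obtain ⟨n, rfl⟩ : ∃ j, n = j + 1 := Nat.exists_eq_succ_of_ne_zero (by simpa using hn)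
        simp [show -((n : ℤ) + 1) = Int.negSucc n from rfl, invQPoch]
      · simp [invQPoch]
  | succ N ih =>
    have h1 := (Equiv.subRight (1 : ℤ)).hasSum_iff.mpr ih
    have h2 := (Equiv.addRight (1 : ℤ)).hasSum_iff.mpr ih
    have hprod : ∏ i ∈ Finset.range (N + 1),
        (1 + ζ * x ^ (2 * i + 1)) * (1 + ζ⁻¹ * x ^ (2 * i + 1)) =
        (1 + x ^ (4 * N + 2)) *
          ∏ i ∈ Finset.range N, (1 + ζ * x ^ (2 * i + 1)) * (1 + ζ⁻¹ * x ^ (2 * i + 1)) +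
        x ^ (2 * N + 1) * ζ *
          ∏ i ∈ Finset.range N, (1 + ζ * x ^ (2 * i + 1)) * (1 + ζ⁻¹ * x ^ (2 * i + 1)) +
        x ^ (2 * N + 1) * ζ⁻¹ *
          ∏ i ∈ Finset.range N, (1 + ζ * x ^ (2 * i + 1)) * (1 + ζ⁻¹ * x ^ (2 * i + 1)) := by
      rw [Finset.prod_range_succ]
      field_simp
      ring
    rw [hprod]
    refine HasSum.congr_fun (((ih.mul_left (1 + x ^ (4 * N + 2))).add
      (h1.mul_left (x ^ (2 * N + 1) * ζ))).add (h2.mul_left (x ^ (2 * N + 1) * ζ⁻¹))) fun k ↦ ?_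
    have hq0 : x ^ 2 ≠ 0 := pow_ne_zero 2 hx0
    have ha1 := invQPoch_succ hq (N + k)
    have ha0 := invQPoch_succ hq (N + k - 1)
    have hb1 := invQPoch_succ hq (N - k)
    have hb0 := invQPoch_succ hq (N - k - 1)
    simp only [sub_add_cancel] at ha0 hb0
    have hP : qPoch (x ^ 2) (2 * (N + 1)) = qPoch (x ^ 2) (2 * N) *
        (1 - (x ^ 2) ^ (2 * N + 1)) * (1 - (x ^ 2) ^ (2 * N + 2)) := by
      rw [qPoch, show 2 * (N + 1) = 2 * N + 1 + 1 by ring, Finset.prod_range_succ,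
        Finset.prod_range_succ, ← qPoch]
    simp only [Function.comp_apply, Equiv.subRight_apply, Equiv.coe_addRight]
    rw [show ((N + 1 : ℕ) : ℤ) + k = N + k + 1 by push_cast; ring,
      show ((N + 1 : ℕ) : ℤ) - k = N - k + 1 by push_cast; ring,
      show (N : ℤ) + (k - 1) = N + k - 1 by ring, show (N : ℤ) - (k - 1) = N - k + 1 by ring,
      show (N : ℤ) + (k + 1) = N + k + 1 by ring, show (N : ℤ) - (k + 1) = N - k - 1 by ring,
      hP, ← ha0, ← hb0, ← ha1, ← hb1]
    generalize invQPoch (x ^ 2) (N + k + 1) = Ra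
    generalize invQPoch (x ^ 2) (N - k + 1) = Rb
    have e1 : x ^ ((k - 1) ^ 2) = x ^ (k ^ 2) * (x ^ k)⁻¹ ^ 2 * x := by
      rw [show (k - 1) ^ 2 = k ^ 2 + (-k) + (-k) + 1 by ring, zpow_add₀ hx0, zpow_add₀ hx0,
        zpow_add₀ hx0, zpow_neg, zpow_one]
      ring
    have e2 : x ^ ((k + 1) ^ 2) = x ^ (k ^ 2) * (x ^ k) ^ 2 * x := by
      rw [show (k + 1) ^ 2 = k ^ 2 + k + k + 1 by ring, zpow_add₀ hx0, zpow_add₀ hx0,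
        zpow_add₀ hx0, zpow_one]
      ring
    have e3 : (x ^ 2) ^ ((N : ℤ) + k) = x ^ (2 * N) * (x ^ k) ^ 2 := by
      rw [zpow_add₀ hq0, zpow_natCast, ← pow_mul, ← zpow_natCast x 2, zpow_comm,
        zpow_natCast (x ^ k)]
    have e4 : (x ^ 2) ^ ((N : ℤ) - k) = x ^ (2 * N) * (x ^ k)⁻¹ ^ 2 := by
      rw [zpow_sub₀ hq0, zpow_natCast, ← pow_mul, ← zpow_natCast x 2, zpow_comm,
        zpow_natCast (x ^ k), inv_pow, div_eq_mul_inv]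
    rw [e1, e2, zpow_add_one₀ hq0, zpow_add_one₀ hq0, e3, e4, zpow_sub_one₀ hζ,
      zpow_add_one₀ hζ]
    have hxk : x ^ k ≠ 0 := zpow_ne_zero k hx0
    generalize x ^ k = y at *
    generalize x ^ (k ^ 2) = u
    generalize ζ ^ k = w
    field_simp
    ring

/-- The Jacobi triple product identity. -/
theorem tsum_eq_tripleProduct {x ζ : ℂ} (hx : ‖x‖ < 1) (hx0 : x ≠ 0) (hζ : ζ ≠ 0)
    (hs : Summable fun k : ℤ ↦ x ^ (k ^ 2) * ζ ^ k) :
    ∑' k : ℤ, x ^ (k ^ 2) * ζ ^ k = eulerProd (x ^ 2) * (oddProd ζ x * oddProd ζ⁻¹ x) := by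
  have hq : ‖x ^ 2‖ < 1 := by
    rw [norm_pow]; exact pow_lt_one₀ (norm_nonneg x) hx two_ne_zero
  have hE := eulerProd_ne_zero hq
  obtain ⟨C, hC⟩ := exists_norm_invQPoch_le hq
  obtain ⟨D, hD⟩ := (Metric.isBounded_range_of_tendsto _ (tendsto_qPoch hq)).exists_norm_le
  have hlim : Tendsto (fun N : ℕ ↦ ∑' k : ℤ, qPoch (x ^ 2) (2 * N) * invQPoch (x ^ 2) (N + k) *
        invQPoch (x ^ 2) (N - k) * (x ^ (k ^ 2) * ζ ^ k)) atTop
      (𝓝 (∑' k : ℤ, eulerProd (x ^ 2) * (eulerProd (x ^ 2))⁻¹ * (eulerProd (x ^ 2))⁻¹ *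
        (x ^ (k ^ 2) * ζ ^ k))) := by
    refine tendsto_tsum_of_dominated_convergence (hs.norm.mul_left (D * C * C)) (fun k ↦ ?_)
      (.of_forall fun N k ↦ ?_)
    · refine Tendsto.mul_const _ (((tendsto_qPoch hq).comp ?_ |>.mul
        ((tendsto_invQPoch hq).comp ?_)).mul ((tendsto_invQPoch hq).comp ?_))
      · exact tendsto_id.const_mul_atTop' two_pos
      · exact tendsto_atTop_add_const_right _ _ tendsto_natCast_atTop_atTop
      · exact tendsto_atTop_add_const_right _ (-k) tendsto_natCast_atTop_atTop
    · rw [norm_mul _ (x ^ (k ^ 2) * ζ ^ k), norm_mul, norm_mul]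
      have hD0 : ‖qPoch (x ^ 2) (2 * N)‖ ≤ D := hD _ ⟨_, rfl⟩
      have hC0 := (norm_nonneg _).trans (hC 0)
      have hD1 := (norm_nonneg _).trans hD0
      gcongr <;> apply hC
  simp only [(hasSum_finite_tripleProduct hx hx0 hζ _).tsum_eq] at hlim
  have hprod := ((multipliable_oddProd ζ hx).hasProd.mul
    (multipliable_oddProd ζ⁻¹ hx).hasProd).tendsto_prod_nat
  have h := tendsto_nhds_unique hlim hprod
  rw [tsum_mul_left, mul_inv_cancel₀ hE, one_mul] at h
  rw [oddProd, oddProd, ← h, mul_inv_cancel_left₀ hE]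

lemma eulerProd_eq_mul_oddProd {x : ℂ} (hx : ‖x‖ < 1) :
    eulerProd x = eulerProd (x ^ 2) * oddProd (-1) x := by
  have hq : ‖x ^ 2‖ < 1 := by
    rw [norm_pow]; exact pow_lt_one₀ (norm_nonneg x) hx two_ne_zero
  have h (k : ℕ) : 1 - (x ^ 2) ^ (k + 1) = 1 - x ^ (2 * k + 1 + 1) := by
    rw [← pow_mul]; ring_nf
  have h' (k : ℕ) : 1 + -1 * x ^ (2 * k + 1) = 1 - x ^ (2 * k + 1) := by ring
  have he := multipliable_oddProd (-1) hx
  have ho := ModularForm.multipliable_one_sub_pow hq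
  simp only [h, h'] at he ho
  simp only [eulerProd, oddProd, h, h']
  rw [mul_comm, tprod_even_mul_odd (f := fun n ↦ 1 - x ^ (n + 1)) he ho]

lemma oddProd_mul_oddProd_neg {x : ℂ} (hx : ‖x‖ < 1) :
    oddProd 1 x * oddProd (-1) x = oddProd (-1) (x ^ 2) := by
  rw [oddProd, oddProd, oddProd,
    ← (multipliable_oddProd 1 hx).tprod_mul (multipliable_oddProd (-1) hx)]
  congr with n
  ring

lemma norm_cexp_pi_I_mul_lt_one {τ : ℂ} (hτ : 0 < τ.im) : ‖cexp (Real.pi * I * τ)‖ < 1 := by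
  rw [norm_exp, Real.exp_lt_one_iff]
  simpa [mul_assoc] using mul_pos Real.pi_pos hτ

lemma jacobiTheta₂_eq_tripleProduct (z : ℂ) {τ : ℂ} (hτ : 0 < τ.im) :
    jacobiTheta₂ z τ = eulerProd (cexp (Real.pi * I * τ) ^ 2) *
      (oddProd (cexp (2 * Real.pi * I * z)) (cexp (Real.pi * I * τ)) *
        oddProd (cexp (2 * Real.pi * I * z))⁻¹ (cexp (Real.pi * I * τ))) := by
  have h (k : ℤ) : jacobiTheta₂_term k z τ =
      cexp (Real.pi * I * τ) ^ (k ^ 2) * cexp (2 * Real.pi * I * z) ^ k := by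
    rw [jacobiTheta₂_term, ← exp_int_mul, ← exp_int_mul, ← exp_add]
    congr 1
    push_cast
    ring
  have hs := (summable_jacobiTheta₂_term_iff z τ).mpr hτ
  simp only [h] at hs
  simp only [jacobiTheta₂, h]
  exact tsum_eq_tripleProduct (norm_cexp_pi_I_mul_lt_one hτ) (exp_ne_zero _) (exp_ne_zero _) hs

lemma dedekindEta_eq (τ : ℂ) :
    dedekindEta τ = cexp (Real.pi * I * τ / 12) * eulerProd (cexp (Real.pi * I * τ) ^ 2) := by
  rw [dedekindEta, eulerProd]
  congr! 4 with n
  rw [← exp_nat_mul, ← exp_nat_mul]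
  congr 1
  push_cast
  ring

lemma dedekindEta_ne_zero {τ : ℂ} (hτ : 0 < τ.im) : dedekindEta τ ≠ 0 := by
  rw [dedekindEta_eq]
  refine mul_ne_zero (exp_ne_zero _) (eulerProd_ne_zero ?_)
  rw [norm_pow]
  exact pow_lt_one₀ (norm_nonneg _) (norm_cexp_pi_I_mul_lt_one hτ) two_ne_zero

lemma dedekindEta_half (τ : ℂ) :
    dedekindEta (τ / 2) = cexp (Real.pi * I * τ / 24) * eulerProd (cexp (Real.pi * I * τ)) := by
  rw [dedekindEta_eq, ← exp_nat_mul,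
    show Real.pi * I * (τ / 2) / 12 = Real.pi * I * τ / 24 by ring,
    show ((2 : ℕ) : ℂ) * (Real.pi * I * (τ / 2)) = Real.pi * I * τ by push_cast; ring]

lemma dedekindEta_two_mul (τ : ℂ) : dedekindEta (2 * τ) =
    cexp (Real.pi * I * τ / 24) ^ 4 * eulerProd ((cexp (Real.pi * I * τ) ^ 2) ^ 2) := by
  rw [dedekindEta_eq, ← exp_nat_mul, ← exp_nat_mul, ← exp_nat_mul, ← exp_nat_mul]
  congr 3 <;> push_cast <;> ring

/-- The product formula `ϑ01(τ, 0) = η(τ/2)² / η(τ)`. -/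
lemma jacobiTheta₂_half_mul_dedekindEta {τ : ℂ} (hτ : 0 < τ.im) :
    jacobiTheta₂ (1 / 2) τ * dedekindEta τ = dedekindEta (τ / 2) ^ 2 := by
  have hx := norm_cexp_pi_I_mul_lt_one hτ
  have hζ : cexp (2 * Real.pi * I * (1 / 2)) = -1 := by
    rw [← exp_pi_mul_I]; ring_nf
  rw [jacobiTheta₂_eq_tripleProduct _ hτ, dedekindEta_half, dedekindEta_eq, hζ, inv_neg_one,
    eulerProd_eq_mul_oddProd hx,
    show Real.pi * I * τ / 12 = (2 : ℕ) * (Real.pi * I * τ / 24) by push_cast; ring, exp_nat_mul]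
  ring

/-- The product formula `ϑ00(τ, 0) = η(τ)⁵ / (η(τ/2)² η(2τ)²)`. -/
lemma jacobiTheta₂_zero_mul_dedekindEta {τ : ℂ} (hτ : 0 < τ.im) :
    jacobiTheta₂ 0 τ * (dedekindEta (τ / 2) * dedekindEta (2 * τ)) ^ 2 = dedekindEta τ ^ 5 := by
  have hx := norm_cexp_pi_I_mul_lt_one hτ
  have hx2 : ‖cexp (Real.pi * I * τ) ^ 2‖ < 1 := by
    rw [norm_pow]; exact pow_lt_one₀ (norm_nonneg _) hx two_ne_zero
  rw [jacobiTheta₂_eq_tripleProduct _ hτ, dedekindEta_half, dedekindEta_two_mul, dedekindEta_eq,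
    mul_zero, exp_zero, inv_one, eulerProd_eq_mul_oddProd hx,
    show Real.pi * I * τ / 12 = (2 : ℕ) * (Real.pi * I * τ / 24) by push_cast; ring, exp_nat_mul]
  have h := eulerProd_eq_mul_oddProd hx2
  rw [← oddProd_mul_oddProd_neg hx] at h
  generalize cexp (Real.pi * I * τ / 24) = y
  generalize cexp (Real.pi * I * τ) = x at *
  calc _ = y ^ 10 * eulerProd (x ^ 2) ^ 3 *
      (eulerProd ((x ^ 2) ^ 2) * (oddProd 1 x * oddProd (-1) x)) ^ 2 := by ring
    _ = _ := by rw [← h]; ring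

lemma jTheta_eq_tsum (j m : ℝ) (τ z : ℂ) : jTheta j m τ z = ∑' n : ℤ, cexp (2 * Real.pi * I * m *
    ((j / (2 * m) + n) ^ 2 * τ + (j / (2 * m) + n) * z)) := by
  simp [jTheta]

lemma jTheta_zero_one (τ z : ℂ) : jTheta 0 1 τ z = jacobiTheta₂ z (2 * τ) := by
  rw [jTheta_eq_tsum, jacobiTheta₂]
  congr with n
  rw [jacobiTheta₂_term]
  congr 1
  push_cast
  ring

lemma jTheta_zero_two (τ z : ℂ) :
    jTheta 0 2 τ z = ∑' n : ℤ, jacobiTheta₂_term (2 * n) z τ := by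
  rw [jTheta_eq_tsum]
  congr with n
  rw [jacobiTheta₂_term]
  congr 1
  push_cast
  ring

lemma jTheta_two_two (τ z : ℂ) :
    jTheta 2 2 τ z = ∑' n : ℤ, jacobiTheta₂_term (2 * n + 1) z τ := by
  rw [jTheta_eq_tsum]
  congr with n
  rw [jacobiTheta₂_term]
  congr 1
  push_cast
  ring

lemma jacobiTheta₂_term_add_half (n : ℤ) (z τ : ℂ) :
    jacobiTheta₂_term n (z + 1 / 2) τ = (-1) ^ n * jacobiTheta₂_term n z τ := by
  rw [jacobiTheta₂_term, jacobiTheta₂_term, ← exp_pi_mul_I, ← exp_int_mul, ← exp_add]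
  congr 1
  ring

lemma tsum_int_even_add_odd {f : ℤ → ℂ} (hf : Summable f) :
    ∑' n : ℤ, f (2 * n) + ∑' n : ℤ, f (2 * n + 1) = ∑' n : ℤ, f n := by
  have he : Function.Injective fun n : ℤ ↦ 2 * n := fun a b h ↦ by simpa using h
  have ho : Function.Injective fun n : ℤ ↦ 2 * n + 1 := fun a b h ↦ by simpa using h
  have hcompl : IsCompl (Set.range fun n : ℤ ↦ 2 * n) (Set.range fun n : ℤ ↦ 2 * n + 1) := by
    simpa [Set.compl_def] using! Int.isCompl_even_odd
  exact (((he.hasSum_range_iff.mpr (hf.comp_injective he).hasSum).add_isCompl hcompl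
    (ho.hasSum_range_iff.mpr (hf.comp_injective ho).hasSum))).tsum_eq.symm

lemma v00_eq {τ : ℂ} (hτ : 0 < τ.im) (z : ℂ) : v00 τ z = jacobiTheta₂ z τ := by
  rw [v00, jTheta_zero_two, jTheta_two_two, jacobiTheta₂]
  exact tsum_int_even_add_odd ((summable_jacobiTheta₂_term_iff z τ).mpr hτ)

lemma v01_eq {τ : ℂ} (hτ : 0 < τ.im) (z : ℂ) : v01 τ z = jacobiTheta₂ (z + 1 / 2) τ := by
  rw [v01, jTheta_zero_two, jTheta_two_two, jacobiTheta₂,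
    ← tsum_int_even_add_odd ((summable_jacobiTheta₂_term_iff _ τ).mpr hτ), sub_eq_add_neg,
    ← tsum_neg]
  congr 1 <;> refine tsum_congr fun n ↦ ?_ <;> rw [jacobiTheta₂_term_add_half]
  · rw [(even_two_mul n).neg_one_zpow, one_mul]
  · rw [(odd_two_mul_add_one n).neg_one_zpow, neg_one_mul]

/-- The addition formula expressing `ϑ(z, 2τ)²` through theta functions of modulus `τ`. -/
lemma jacobiTheta₂_two_mul_sq {τ : ℂ} (hτ : 0 < τ.im) (z : ℂ) :
    jacobiTheta₂ z (2 * τ) ^ 2 = 1 / 2 * (jacobiTheta₂ 0 τ * jacobiTheta₂ z τ +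
      jacobiTheta₂ (1 / 2) τ * jacobiTheta₂ (z + 1 / 2) τ) := by
  have hτ2 : 0 < (2 * τ).im := by simpa using hτ
  have hs {τ : ℂ} (hτ : 0 < τ.im) (z : ℂ) := ((summable_jacobiTheta₂_term_iff z τ).mpr hτ).norm
  simp only [sq, jacobiTheta₂]
  rw [tsum_mul_tsum_of_summable_norm (hs hτ2 z) (hs hτ2 z),
    tsum_mul_tsum_of_summable_norm (hs hτ 0) (hs hτ z),
    tsum_mul_tsum_of_summable_norm (hs hτ (1 / 2)) (hs hτ (z + 1 / 2)),
    ← (summable_mul_of_summable_norm (hs hτ 0) (hs hτ z)).tsum_add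
      (summable_mul_of_summable_norm (hs hτ (1 / 2)) (hs hτ (z + 1 / 2))), ← tsum_mul_left]
  have hinj : Function.Injective fun p : ℤ × ℤ ↦ (p.1 - p.2, p.1 + p.2) := by
    rintro ⟨a, b⟩ ⟨c, d⟩ h
    simp only [Prod.mk.injEq] at h ⊢
    lia
  have hhalf (n : ℤ) : jacobiTheta₂_term n (1 / 2) τ = (-1) ^ n * jacobiTheta₂_term n 0 τ := by
    simpa using jacobiTheta₂_term_add_half n 0 τ
  have hcomb (k l : ℤ) : 1 / 2 * (jacobiTheta₂_term k 0 τ * jacobiTheta₂_term l z τ +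
      jacobiTheta₂_term k (1 / 2) τ * jacobiTheta₂_term l (z + 1 / 2) τ) =
      (1 + (-1) ^ (k + l)) / 2 * (jacobiTheta₂_term k 0 τ * jacobiTheta₂_term l z τ) := by
    rw [hhalf, jacobiTheta₂_term_add_half, zpow_add₀ (by norm_num)]
    ring
  simp only [hcomb]
  refine Eq.trans (tsum_congr ?_) (hinj.tsum_eq ?_)
  · rintro ⟨m, n⟩
    have he : (-1 : ℂ) ^ (m - n + (m + n)) = 1 := Even.neg_one_zpow ⟨m, by ring⟩
    simp only [he, jacobiTheta₂_term, ← exp_add]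
    norm_num
    congr 1
    ring
  · rintro ⟨k, l⟩ hkl
    rcases Int.even_or_odd (k + l) with ⟨m, hm⟩ | h
    · exact ⟨(m, m - k), by simp; lia⟩
    · simp [h.neg_one_zpow] at hkl

/-- Proposition 3.2 (2). -/
theorem stmt_5 (τ : ℂ) (hτ : 0 < τ.im) (z : ℂ) :
    ch10 τ z ^ 2 =
      -(1 / 2) * (dedekindEta τ ^ 3 / (dedekindEta (τ / 2) * dedekindEta (2 * τ))
          + dedekindEta (τ / 2) * dedekindEta (2 * τ) / dedekindEta τ ^ 2) * ch20 τ z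
        + (1 / 2) * (dedekindEta τ ^ 3 / (dedekindEta (τ / 2) * dedekindEta (2 * τ))
          - dedekindEta (τ / 2) * dedekindEta (2 * τ) / dedekindEta τ ^ 2) * ch22 τ z := by
  have hτ1 : 0 < (τ / 2).im := by simpa using hτ
  have hτ2 : 0 < (2 * τ).im := by simpa using hτ
  have ha := dedekindEta_ne_zero hτ1
  have hb := dedekindEta_ne_zero hτ
  have hc := dedekindEta_ne_zero hτ2
  have h0 := jacobiTheta₂_zero_mul_dedekindEta hτ
  have h1 := jacobiTheta₂_half_mul_dedekindEta hτ
  rw [← eq_div_iff (by positivity)] at h0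
  rw [← eq_div_iff hb] at h1
  rw [ch10, ch20, ch22, jTheta_zero_one, neg_div, neg_sq, div_pow, jacobiTheta₂_two_mul_sq hτ,
    v00_eq hτ, v01_eq hτ, h0, h1]
  field_simp
  ring
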